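/- Let z ∈ ℂ with Im z > 0. Then the matrix A^z_N + i C^z_N is invertible, for Haar-almost every unitary U the matrix 1 − U is invertible and the Green matrix G^z_N(0, Z(U)) with left Dirichlet boundary condition Ẑ = 0 and right boundary condition Z(U) = −i(1+U)(1−U)^{-1} is defined, the map U ↦ G^z_N(0, Z(U)) is Bochner integrable with respect to normalized Haar measure on U(L), and ∫_{U(L)} G^z_N(0, Z(U)) dU = [A^z_N + i C^z_N]^{-1} [B^z_N + i D^z_N]. -/

import Mathlib

open MeasureTheory Matrix
open scoped ComplexOrder

noncomputable section

/-- The space of complex `L × L` matrices. -/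
abbrev Mat (L : ℕ) := Matrix (Fin L) (Fin L) ℂ

/-- The `2L × 2L` transfer matrix `[[(z − V)T⁻¹, −T^*], [T⁻¹, 0]]`. -/
def transferM (L : ℕ) (z : ℂ) (T V : Mat L) : Matrix (Fin L ⊕ Fin L) (Fin L ⊕ Fin L) ℂ :=
  Matrix.fromBlocks ((z • (1 : Mat L) - V) * T⁻¹) (-(Tᴴ)) T⁻¹ 0

/-- The transfer matrix across the sample, `𝒯^z(N,0) = 𝒯_N^z ⋯ 𝒯_1^z`. -/
def transferProd (L N : ℕ) (T V : ℕ → Mat L) (z : ℂ) :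
    Matrix (Fin L ⊕ Fin L) (Fin L ⊕ Fin L) ℂ :=
  (((List.range N).map (fun n => transferM L z (T (n + 1)) (V (n + 1)))).reverse).prod

def blockA (L N : ℕ) (T V : ℕ → Mat L) (z : ℂ) : Mat L := (transferProd L N T V z).toBlocks₁₁
def blockB (L N : ℕ) (T V : ℕ → Mat L) (z : ℂ) : Mat L := (transferProd L N T V z).toBlocks₁₂
def blockC (L N : ℕ) (T V : ℕ → Mat L) (z : ℂ) : Mat L := (transferProd L N T V z).toBlocks₂₁
def blockD (L N : ℕ) (T V : ℕ → Mat L) (z : ℂ) : Mat L := (transferProd L N T V z).toBlocks₂₂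

/-- The block tridiagonal Jacobi matrix `H^N_{Ẑ,Z}` (sites `1,…,N` are indexed by `Fin N`). -/
def jacobi (L N : ℕ) (T V : ℕ → Mat L) (Zh Z : Mat L) :
    Matrix (Fin N × Fin L) (Fin N × Fin L) ℂ :=
  Matrix.of fun p q =>
    if p.1 = q.1 then
      (V (p.1.val + 1) - (if p.1.val = 0 then Zh else 0)
        - (if p.1.val = N - 1 then Z else 0)) p.2 q.2
    else if q.1.val = p.1.val + 1 then T (p.1.val + 2) p.2 q.2
    else if p.1.val = q.1.val + 1 then (T (q.1.val + 2))ᴴ p.2 q.2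
    else 0

/-- The Green matrix `G^z_N(Ẑ,Z) = π₁^* (H^N_{Ẑ,Z} − z)⁻¹ π₁`. -/
def green (L N : ℕ) (hN : 0 < N) (T V : ℕ → Mat L) (Zh Z : Mat L) (z : ℂ) : Mat L :=
  Matrix.of fun i j => (jacobi L N T V Zh Z - z • 1)⁻¹ (⟨0, hN⟩, i) (⟨0, hN⟩, j)

instance (L : ℕ) : MeasurableSpace (Matrix.unitaryGroup (Fin L) ℂ) := borel _

/-- The right boundary condition `Z(U) = −i(1+U)(1−U)⁻¹` associated with a unitary `U`. -/
def ZofU (L : ℕ) (U : Matrix.unitaryGroup (Fin L) ℂ) : Mat L :=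
  -(Complex.I • ((1 + (U : Mat L)) * (1 - (U : Mat L))⁻¹))

open scoped Matrix.Norms.L2Operator MatrixOrder

theorem transferProd_succ (L N : ℕ) (T V : ℕ → Mat L) (z : ℂ) :
    transferProd L (N + 1) T V z =
      transferM L z (T (N + 1)) (V (N + 1)) * transferProd L N T V z := by
  simp [transferProd, List.range_succ]

theorem transferProd_eq_fromBlocks (L N : ℕ) (T V : ℕ → Mat L) (z : ℂ) :
    transferProd L N T V z = fromBlocks (blockA L N T V z) (blockB L N T V z)
      (blockC L N T V z) (blockD L N T V z) :=
  (fromBlocks_toBlocks _).symm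

theorem blockA_succ (L N : ℕ) (T V : ℕ → Mat L) (z : ℂ) :
    blockA L (N + 1) T V z = (z • (1 : Mat L) - V (N + 1)) * blockC L (N + 1) T V z
      - (T (N + 1))ᴴ * blockC L N T V z := by
  simp only [blockA, blockC]
  rw [transferProd_succ, transferProd_eq_fromBlocks, transferM, fromBlocks_multiply]
  simp [mul_assoc, sub_eq_add_neg]

theorem blockC_succ (L N : ℕ) (T V : ℕ → Mat L) (z : ℂ) :
    blockC L (N + 1) T V z = (T (N + 1))⁻¹ * blockA L N T V z := by
  rw [blockC, transferProd_succ, transferProd_eq_fromBlocks, transferM, fromBlocks_multiply]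
  simp

theorem blockA_blockC_zero (L : ℕ) (T V : ℕ → Mat L) (z : ℂ) :
    blockA L 0 T V z = 1 ∧ blockC L 0 T V z = 0 := by
  constructor <;> ext i j <;> simp [blockA, blockC, transferProd, toBlocks₁₁, toBlocks₂₁,
    one_apply]

/-- The symplectic form `i (Aᴴ C - Cᴴ A)` of the first block column. -/
def sympForm {L : ℕ} (A C : Mat L) : Mat L := Complex.I • (Aᴴ * C - Cᴴ * A)

theorem sympForm_succ {L N : ℕ} {T V : ℕ → Mat L} {z : ℂ} (hT : IsUnit (T (N + 1)))
    (hV : (V (N + 1)).IsHermitian) :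
    sympForm (blockA L (N + 1) T V z) (blockC L (N + 1) T V z) =
      sympForm (blockA L N T V z) (blockC L N T V z) +
        (2 * z.im : ℝ) • ((blockC L (N + 1) T V z)ᴴ * blockC L (N + 1) T V z) := by
  have hA : T (N + 1) * blockC L (N + 1) T V z = blockA L N T V z := by
    rw [blockC_succ, ← mul_assoc, mul_nonsing_inv _ ((isUnit_iff_isUnit_det _).1 hT), one_mul]
  rw [blockA_succ, ← hA]
  generalize blockC L (N + 1) T V z = c
  generalize blockC L N T V z = d
  have hz : ((2 * z.im : ℝ) : ℂ) = Complex.I * (star z - z) := by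
    apply Complex.ext <;> simp; ring
  rw [← Complex.coe_smul, hz]
  simp only [sympForm, conjTranspose_sub, conjTranspose_mul, conjTranspose_conjTranspose,
    conjTranspose_smul, conjTranspose_one, hV.eq, mul_smul]
  rw [← smul_add]
  congr 1
  simp only [sub_smul, mul_sub, sub_mul, smul_mul_assoc, mul_smul_comm, one_mul, mul_one,
    mul_assoc]
  abel

theorem sympForm_posDef {L N : ℕ} (hN : 1 ≤ N) {T V : ℕ → Mat L} (hT1 : T 1 = 1)
    (hTinv : ∀ n, 2 ≤ n → n ≤ N → IsUnit (T n))
    (hV : ∀ n, 1 ≤ n → n ≤ N → (V n).IsHermitian) {z : ℂ} (hz : 0 < z.im) :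
    (sympForm (blockA L N T V z) (blockC L N T V z)).PosDef := by
  induction N, hN using Nat.le_induction with
  | base =>
    rw [sympForm_succ (by simp [hT1]) (hV 1 le_rfl le_rfl)]
    simp only [blockC_succ, blockA_blockC_zero, zero_add, hT1, sympForm]
    simpa using (PosDef.one (n := Fin L) (R := ℂ)).smul (show (0 : ℝ) < 2 * z.im by positivity)
  | succ n hn ih =>
    rw [sympForm_succ (hTinv _ (by omega) le_rfl) (hV _ (by omega) le_rfl)]
    exact (ih (fun k h1 h2 => hTinv k h1 (by omega))
      fun k h1 h2 => hV k h1 (by omega)).add_posSemidef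
      ((posSemidef_conjTranspose_mul_self _).smul (by positivity))

theorem conjTranspose_mul_self_add_sub {L : ℕ} (A C : Mat L) :
    (A + Complex.I • C)ᴴ * (A + Complex.I • C) =
      (A - Complex.I • C)ᴴ * (A - Complex.I • C) + (2 : ℝ) • sympForm A C := by
  rw [two_smul]
  simp only [sympForm, conjTranspose_sub, conjTranspose_add, conjTranspose_smul, mul_add, add_mul,
    mul_sub, sub_mul, mul_smul_comm, smul_sub, Complex.star_def, Complex.conj_I,
    neg_smul, neg_mul, smul_mul_assoc, smul_neg, smul_add, smul_smul, Complex.I_mul_I,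
    neg_neg, one_smul]
  abel

theorem isUnit_add_I_smul {L : ℕ} {A C : Mat L} (h : (sympForm A C).PosDef) :
    IsUnit (A + Complex.I • C) := by
  have h2 : ((A + Complex.I • C)ᴴ * (A + Complex.I • C)).PosDef := by
    rw [conjTranspose_mul_self_add_sub]
    exact PosDef.posSemidef_add (posSemidef_conjTranspose_mul_self _) (h.smul two_pos)
  have := (isUnit_iff_isUnit_det _).1 h2.isUnit
  rw [det_mul] at this
  exact (isUnit_iff_isUnit_det _).2 (isUnit_of_mul_isUnit_right this)

theorem norm_lt_one_of_posDef {L : ℕ} {K : Mat L} (h : (1 - Kᴴ * K).PosDef) : ‖K‖ < 1 := by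
  nontriviality Mat L
  have hs := h.isStrictlyPositive
  obtain ⟨r, hr, hle⟩ : ∃ r > 0, algebraMap ℝ (Mat L) r ≤ 1 - Kᴴ * K :=
    (CFC.exists_pos_algebraMap_le_iff hs.isSelfAdjoint).2 fun x hx ↦ hs.spectrum_pos hx
  have h0 : 0 ≤ Kᴴ * K := star_mul_self_nonneg K
  have h1 : Kᴴ * K ≤ algebraMap ℝ (Mat L) (1 - r) := by
    rw [map_sub, map_one]
    exact le_sub_comm.1 hle
  have hr1 : 0 ≤ 1 - r := 
    spectrum_nonneg_of_nonneg (h0.trans h1) (by rw [spectrum.scalar_eq]; rfl)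
  have h2 := (CStarAlgebra.norm_le_iff_le_algebraMap _ hr1 h0).2 h1
  rw [l2_opNorm_conjTranspose_mul_self] at h2
  nlinarith [norm_nonneg K]

theorem norm_cayley_lt_one {L : ℕ} {A C : Mat L} (h : (sympForm A C).PosDef) :
    ‖(A - Complex.I • C) * (A + Complex.I • C)⁻¹‖ < 1 := by
  have hP := isUnit_add_I_smul h
  have hP' := (isUnit_iff_isUnit_det _).1 hP
  apply norm_lt_one_of_posDef
  have h1 : (1 : Mat L) = ((A + Complex.I • C)⁻¹)ᴴ *
      ((A + Complex.I • C)ᴴ * (A + Complex.I • C)) * (A + Complex.I • C)⁻¹ := by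
    rw [← mul_assoc, ← conjTranspose_mul, mul_assoc, mul_nonsing_inv _ hP']
    simp
  rw [conjTranspose_mul_self_add_sub] at h1
  nth_rw 1 [h1]
  have h2 := (h.smul (two_pos (α := ℝ))).conjTranspose_mul_mul_same
    (B := (A + Complex.I • C)⁻¹) (mulVec_injective_of_isUnit (isUnit_nonsing_inv_iff.2 hP))
  convert h2 using 1
  simp only [conjTranspose_mul, mul_add, add_mul, mul_assoc]
  abel

theorem jacobi_eq_add (L N : ℕ) (T V : ℕ → Mat L) (Z : Mat L) (z : ℂ) (k l : Fin N)
    (i j : Fin L) :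
    (jacobi L N T V 0 Z - z • 1) (k, i) (l, j) =
      (if k = l then (V (k + 1) - (if k.val = N - 1 then Z else 0) - z • 1) i j else 0) +
      (if l.val = k + 1 then T (k + 2) i j else 0) +
      (if k.val = l + 1 then (T (k + 1))ᴴ i j else 0) := by
  rcases eq_or_ne k l with rfl | hkl
  · simp [jacobi, one_apply]
  · by_cases h1 : l.val = k + 1
    · have h2 : k.val ≠ l + 1 := by omega
      simp [jacobi, hkl, h1, one_apply, add_assoc]
    · by_cases h2 : k.val = l + 1
      · simp [jacobi, hkl, h2, one_apply, add_assoc]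
      · simp [jacobi, hkl, h1, h2, one_apply]

theorem sum_ite_val_eq {M : Type*} [AddCommMonoid M] {N : ℕ} (m : ℕ) (f : ℕ → M) :
    ∑ l : Fin N, (if l.val = m then f l else 0) = if m < N then f m else 0 := by
  split_ifs with h
  · rw [Finset.sum_eq_single ⟨m, h⟩] <;> simp +contextual [Fin.ext_iff]
  · exact Finset.sum_eq_zero fun l _ => if_neg (by omega)

/-- The sequence `φ` extended by `-v` on the left, as seen by the transfer matrices;
the value at `k + 1` is the `k`-th block of `φ`. -/
def boundarySeq {L N : ℕ} (φ : Fin N × Fin L → ℂ) (v : Fin L → ℂ) : ℕ → Fin L → ℂ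
  | 0 => -v
  | k + 1 => fun j => if h : k < N then φ (⟨k, h⟩, j) else 0

theorem jacobi_mulVec {L N : ℕ} {T V : ℕ → Mat L} (hT1 : T 1 = 1) {Z : Mat L} {z : ℂ}
    {φ : Fin N × Fin L → ℂ} {v : Fin L → ℂ}
    (h : (jacobi L N T V 0 Z - z • 1) *ᵥ φ = fun p => if p.1.val = 0 then v p.2 else 0)
    {k : ℕ} (hk : k < N) :
    (V (k + 1) - (if k = N - 1 then Z else 0) - z • 1) *ᵥ boundarySeq φ v (k + 1) +
      T (k + 2) *ᵥ boundarySeq φ v (k + 2) + (T (k + 1))ᴴ *ᵥ boundarySeq φ v k = 0 := by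
  ext i
  have hφ (l : Fin N) (j : Fin L) : φ (l, j) = boundarySeq φ v (l + 1) j := by
    simp [boundarySeq]
  have hsum : ((jacobi L N T V 0 Z - z • 1) *ᵥ φ) (⟨k, hk⟩, i) = ∑ l : Fin N,
      ((if (⟨k, hk⟩ : Fin N) = l then ((V (k + 1) - (if k = N - 1 then Z else 0) - z • 1) *ᵥ
          boundarySeq φ v (l + 1)) i else 0) +
        (if l.val = k + 1 then (T (k + 2) *ᵥ boundarySeq φ v (l + 1)) i else 0) +
        (if k = l.val + 1 then ((T (k + 1))ᴴ *ᵥ boundarySeq φ v (l + 1)) i else 0)) := by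
    simp only [mulVec, dotProduct, Fintype.sum_prod_type, jacobi_eq_add, hφ]
    refine Finset.sum_congr rfl fun l _ => ?_
    simp only [add_mul, Finset.sum_add_distrib, ite_mul, zero_mul]
    congr 1
    · congr 1 <;> split_ifs <;> simp
    · split_ifs <;> simp
  have hT : (if k + 1 < N then (T (k + 2) *ᵥ boundarySeq φ v (k + 2)) i else 0) =
      (T (k + 2) *ᵥ boundarySeq φ v (k + 2)) i := by
    split_ifs with hkN
    · rfl
    · simp [boundarySeq, hkN, mulVec, dotProduct]
  rw [h, Finset.sum_add_distrib, Finset.sum_add_distrib, Finset.sum_ite_eq,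
    if_pos (Finset.mem_univ _),
    sum_ite_val_eq (k + 1) fun l => (T (k + 2) *ᵥ boundarySeq φ v (l + 1)) i, hT] at hsum
  cases k with
  | zero =>
    simp only [Pi.add_apply, Pi.zero_apply, zero_add, hT1, conjTranspose_one, one_mulVec] at hsum ⊢
    simp [boundarySeq] at hsum ⊢
    rw [← hsum, add_neg_cancel]
  | succ m =>
    simp only [Nat.add_right_cancel_iff, eq_comm (a := m)] at hsum
    rw [sum_ite_val_eq m fun l => ((T (m + 1 + 1))ᴴ *ᵥ boundarySeq φ v (l + 1)) i,
      if_pos (show m < N by omega), if_neg m.succ_ne_zero] at hsum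
    exact hsum.symm

theorem transferM_mulVec {L : ℕ} {z : ℂ} {T V : Mat L} (hT : IsUnit T) (a c : Fin L → ℂ) :
    transferM L z T V *ᵥ Sum.elim (T *ᵥ a) c = Sum.elim (z • a - V *ᵥ a - Tᴴ *ᵥ c) a := by
  have hT' : T⁻¹ * T = 1 := nonsing_inv_mul _ ((isUnit_iff_isUnit_det _).1 hT)
  simp [transferM, fromBlocks_mulVec, mulVec_mulVec, mul_assoc, hT', sub_mulVec, smul_mulVec,
    neg_mulVec, ← sub_eq_add_neg]

theorem transferProd_mulVec {L N : ℕ} {T V : ℕ → Mat L} (hT1 : T 1 = 1)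
    (hTinv : ∀ n, 2 ≤ n → n ≤ N → IsUnit (T n)) {Z : Mat L} {z : ℂ}
    {φ : Fin N × Fin L → ℂ} {v : Fin L → ℂ}
    (h : (jacobi L N T V 0 Z - z • 1) *ᵥ φ = fun p => if p.1.val = 0 then v p.2 else 0)
    {k : ℕ} (hk : k < N) :
    transferProd L k T V z *ᵥ Sum.elim (boundarySeq φ v 1) (-v) =
      Sum.elim (T (k + 1) *ᵥ boundarySeq φ v (k + 1)) (boundarySeq φ v k) := by
  induction k with
  | zero => simp [transferProd, hT1, boundarySeq]
  | succ k ih =>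
    have hT : IsUnit (T (k + 1)) := by
      rcases k with _ | k
      · simp [hT1]
      · exact hTinv _ (by omega) (by omega)
    have hr := jacobi_mulVec hT1 h (k := k) (by omega)
    rw [if_neg (by omega)] at hr
    rw [transferProd_succ, ← mulVec_mulVec, ih (by omega), transferM_mulVec hT]
    congr 1
    rw [← sub_eq_zero, ← neg_eq_zero, ← hr]
    simp only [sub_mulVec, smul_mulVec, one_mulVec, zero_mulVec]
    abel

theorem transferProd_mulVec_last {L N : ℕ} (hN : 1 ≤ N) {T V : ℕ → Mat L} (hT1 : T 1 = 1)
    (hTinv : ∀ n, 2 ≤ n → n ≤ N → IsUnit (T n)) {Z : Mat L} {z : ℂ}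
    {φ : Fin N × Fin L → ℂ} {v : Fin L → ℂ}
    (h : (jacobi L N T V 0 Z - z • 1) *ᵥ φ = fun p => if p.1.val = 0 then v p.2 else 0) :
    transferProd L N T V z *ᵥ Sum.elim (boundarySeq φ v 1) (-v) =
      Sum.elim (-(Z *ᵥ boundarySeq φ v N)) (boundarySeq φ v N) := by
  obtain ⟨k, rfl⟩ := Nat.exists_eq_add_of_le' hN
  have hT : IsUnit (T (k + 1)) := by
    rcases k with _ | k
    · simp [hT1]
    · exact hTinv _ (by omega) (by omega)
  have hr := jacobi_mulVec hT1 h (k := k) (by omega)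
  have h0 : boundarySeq φ v (k + 2) = 0 := by ext; simp [boundarySeq]
  rw [if_pos (by omega), h0, mulVec_zero, add_zero] at hr
  rw [transferProd_succ, ← mulVec_mulVec, transferProd_mulVec hT1 hTinv h (by omega),
    transferM_mulVec hT]
  congr 1
  rw [← sub_eq_zero, ← neg_eq_zero, ← hr]
  simp only [sub_mulVec, smul_mulVec, one_mulVec]
  abel

theorem add_mul_mulVec_boundarySeq {L N : ℕ} (hN : 1 ≤ N) {T V : ℕ → Mat L} (hT1 : T 1 = 1)
    (hTinv : ∀ n, 2 ≤ n → n ≤ N → IsUnit (T n)) {Z : Mat L} {z : ℂ}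
    {φ : Fin N × Fin L → ℂ} {v : Fin L → ℂ}
    (h : (jacobi L N T V 0 Z - z • 1) *ᵥ φ = fun p => if p.1.val = 0 then v p.2 else 0) :
    (blockA L N T V z + Z * blockC L N T V z) *ᵥ boundarySeq φ v 1 =
      (blockB L N T V z + Z * blockD L N T V z) *ᵥ v := by
  have hl := transferProd_mulVec_last hN hT1 hTinv h
  rw [transferProd_eq_fromBlocks, fromBlocks_mulVec] at hl
  have h1 := congrArg (· ∘ Sum.inl) hl
  have h2 := congrArg (· ∘ Sum.inr) hl
  simp only [Sum.elim_comp_inl, Sum.elim_comp_inr, mulVec_neg] at h1 h2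
  rw [← h2, ← sub_eq_zero] at h1
  rw [← sub_eq_zero, ← h1]
  simp only [add_mulVec, mulVec_add, mulVec_neg, mulVec_mulVec]
  abel

theorem isUnit_jacobi_sub {L N : ℕ} (hN : 1 ≤ N) {T V : ℕ → Mat L} (hT1 : T 1 = 1)
    (hTinv : ∀ n, 2 ≤ n → n ≤ N → IsUnit (T n)) {Z : Mat L} {z : ℂ}
    (hZ : IsUnit (blockA L N T V z + Z * blockC L N T V z)) :
    IsUnit (jacobi L N T V 0 Z - z • 1) := by
  rw [← mulVec_injective_iff_isUnit]
  refine (injective_iff_map_eq_zero (mulVecLin (jacobi L N T V 0 Z - z • 1))).2 fun φ hφ => ?_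
  have h : (jacobi L N T V 0 Z - z • 1) *ᵥ φ =
      fun p => if p.1.val = 0 then (0 : Fin L → ℂ) p.2 else 0 := by
    rw [← mulVecLin_apply, hφ]; ext; simp
  have h1 : boundarySeq φ 0 1 = 0 := by
    apply mulVec_injective_of_isUnit hZ
    simp [add_mul_mulVec_boundarySeq hN hT1 hTinv h]
  have hb (k : ℕ) (hk : k ≤ N) : boundarySeq φ 0 k = 0 := by
    rcases hk.lt_or_eq with hk | rfl
    · have := congrArg (· ∘ Sum.inr) (transferProd_mulVec hT1 hTinv h hk)
      simpa [h1] using this.symm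
    · have := congrArg (· ∘ Sum.inr) (transferProd_mulVec_last hN hT1 hTinv h)
      simpa [h1] using this.symm
  ext ⟨k, j⟩
  simpa [boundarySeq] using congrFun (hb (k + 1) k.2) j

theorem green_eq {L N : ℕ} (hN : 1 ≤ N) {T V : ℕ → Mat L} (hT1 : T 1 = 1)
    (hTinv : ∀ n, 2 ≤ n → n ≤ N → IsUnit (T n)) {Z : Mat L} {z : ℂ}
    (hZ : IsUnit (blockA L N T V z + Z * blockC L N T V z)) :
    green L N hN T V 0 Z z = (blockA L N T V z + Z * blockC L N T V z)⁻¹ *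
      (blockB L N T V z + Z * blockD L N T V z) := by
  have hJ := (isUnit_iff_isUnit_det _).1 (isUnit_jacobi_sub hN hT1 hTinv hZ)
  have hZ' := (isUnit_iff_isUnit_det _).1 hZ
  ext i j
  have h : (jacobi L N T V 0 Z - z • 1) *ᵥ
      ((jacobi L N T V 0 Z - z • 1)⁻¹ *ᵥ Pi.single (⟨0, hN⟩, j) 1) =
      fun p => if p.1.val = 0 then (Pi.single j 1 : Fin L → ℂ) p.2 else 0 := by
    rw [mulVec_mulVec, mul_nonsing_inv _ hJ, one_mulVec]
    ext ⟨k, l⟩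
    by_cases hk : k.val = 0 <;> simp [Pi.single_apply, Prod.ext_iff, Fin.ext_iff, hk]
  have hb := congrArg ((blockA L N T V z + Z * blockC L N T V z)⁻¹ *ᵥ ·)
    (add_mul_mulVec_boundarySeq hN hT1 hTinv h)
  simp only [mulVec_mulVec, nonsing_inv_mul _ hZ', one_mulVec] at hb
  have hc := congrFun hb i
  have hN' : 0 < N := hN
  simpa [boundarySeq, hN', green] using hc

theorem one_sub_mul_add_ZofU_mul {L : ℕ} {U : unitaryGroup (Fin L) ℂ}
    (hU : IsUnit (1 - (U : Mat L))) (A C : Mat L) :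
    (1 - (U : Mat L)) * (A + ZofU L U * C) =
      -(U : Mat L) * ((A + Complex.I • C) - star (U : Mat L) * (A - Complex.I • C)) := by
  have hU' := (isUnit_iff_isUnit_det _).1 hU
  have hZ : (1 - (U : Mat L)) * ZofU L U = -(Complex.I • (1 + (U : Mat L))) := by
    have hc : (1 - (U : Mat L)) * (1 + U) = (1 + (U : Mat L)) * (1 - U) := by noncomm_ring
    rw [ZofU, mul_neg, mul_smul_comm, ← mul_assoc, hc, mul_assoc, mul_nonsing_inv _ hU', mul_one]
  have hs : (U : Mat L) * star (U : Mat L) = 1 := Unitary.coe_mul_star_self U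
  rw [mul_add, ← mul_assoc _ (ZofU L U), hZ, mul_sub, ← mul_assoc _ (star _),
    neg_mul (U : Mat L) (star _), hs]
  simp only [sub_mul, neg_mul, add_mul, mul_add, one_mul, smul_mul_assoc, mul_smul_comm, smul_add,
    smul_neg]
  abel

theorem add_I_smul_sub_mul {L : ℕ} {A C : Mat L} (hP : IsUnit (A + Complex.I • C)) (W : Mat L) :
    (A + Complex.I • C) - W * (A - Complex.I • C) =
      (1 - W * ((A - Complex.I • C) * (A + Complex.I • C)⁻¹)) * (A + Complex.I • C) := by
  rw [sub_mul, one_mul, mul_assoc, mul_assoc,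
    nonsing_inv_mul _ ((isUnit_iff_isUnit_det _).1 hP), mul_one]

instance (L : ℕ) : BorelSpace (unitaryGroup (Fin L) ℂ) := ⟨rfl⟩

theorem norm_star_unitary_mul_le {L : ℕ} (U : unitaryGroup (Fin L) ℂ) (K : Mat L) :
    ‖star (U : Mat L) * K‖ ≤ ‖K‖ :=
  (CStarRing.norm_coe_unitary_mul (star U) K).le

theorem isUnit_add_ZofU_mul {L : ℕ} {U : unitaryGroup (Fin L) ℂ}
    (hU : IsUnit (1 - (U : Mat L))) {A C : Mat L} (h : (sympForm A C).PosDef) :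
    IsUnit (A + ZofU L U * C) := by
  have hP := isUnit_add_I_smul h
  have hX : IsUnit (1 - star (U : Mat L) * ((A - Complex.I • C) * (A + Complex.I • C)⁻¹)) :=
    isUnit_one_sub_of_norm_lt_one ((norm_star_unitary_mul_le _ _).trans_lt (norm_cayley_lt_one h))
  have hU1 : IsUnit (-(U : Mat L)) := (Unitary.toUnits U).isUnit.neg
  have h1 := one_sub_mul_add_ZofU_mul hU A C
  rw [add_I_smul_sub_mul hP] at h1
  have h2 := hU1.mul (hX.mul hP)
  rw [← h1] at h2
  exact (IsUnit.mul_iff.1 h2).2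

/-- The general term of the Neumann series of the Green matrix. -/
def neumannTerm {L : ℕ} (a K M : Mat L) (n : ℕ) (U : unitaryGroup (Fin L) ℂ) : Mat L :=
  a * ((star (U : Mat L) * K) ^ n * (star (U : Mat L) * M))

theorem continuous_neumannTerm {L : ℕ} (a K M : Mat L) (n : ℕ) :
    Continuous (neumannTerm a K M n) := by
  unfold neumannTerm
  fun_prop

theorem norm_neumannTerm_le {L : ℕ} (a K M : Mat L) (n : ℕ) (U : unitaryGroup (Fin L) ℂ) :
    ‖neumannTerm a K M n U‖ ≤ ‖a‖ * (‖K‖ ^ n * ‖M‖) := by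
  nontriviality Mat L
  refine (norm_mul_le _ _).trans ?_
  gcongr
  refine (norm_mul_le _ _).trans ?_
  gcongr
  · refine (norm_pow_le _ _).trans ?_
    gcongr
    exact norm_star_unitary_mul_le U K
  · exact norm_star_unitary_mul_le U M

theorem summable_neumannBound {L : ℕ} (a : Mat L) {K : Mat L} (hK : ‖K‖ < 1) (M : Mat L) :
    Summable fun n : ℕ => ‖a‖ * (‖K‖ ^ n * ‖M‖) :=
  ((summable_geometric_of_lt_one (norm_nonneg K) hK).mul_right _).mul_left _

theorem inv_add_ZofU_mul {L : ℕ} {U : unitaryGroup (Fin L) ℂ}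
    (hU : IsUnit (1 - (U : Mat L))) {A B C D : Mat L} (h : (sympForm A C).PosDef) :
    (A + ZofU L U * C)⁻¹ * (B + ZofU L U * D) =
      (A + Complex.I • C)⁻¹ * (B + Complex.I • D) +
        ∑' n, neumannTerm (A + Complex.I • C)⁻¹ ((A - Complex.I • C) * (A + Complex.I • C)⁻¹)
          ((A - Complex.I • C) * (A + Complex.I • C)⁻¹ * (B + Complex.I • D) -
            (B - Complex.I • D)) n U := by
  have hP := isUnit_add_I_smul h
  have hP' := (isUnit_iff_isUnit_det _).1 hP
  have hK := norm_cayley_lt_one h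
  have h1 := one_sub_mul_add_ZofU_mul hU A C
  have h2 := one_sub_mul_add_ZofU_mul hU B D
  rw [add_I_smul_sub_mul hP] at h1
  have hAZ := isUnit_add_ZofU_mul hU h
  have hU1 : IsUnit (-(U : Mat L)) := (Unitary.toUnits U).isUnit.neg
  generalize (A - Complex.I • C) * (A + Complex.I • C)⁻¹ = K at *
  generalize A + Complex.I • C = P at *
  generalize B + Complex.I • D = R at *
  generalize B - Complex.I • D = S at *
  generalize A + ZofU L U * C = Y at *
  generalize B + ZofU L U * D = X at *
  have hX : ‖star (U : Mat L) * K‖ < 1 := (norm_star_unitary_mul_le U K).trans_lt hK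
  have hsum : ∑' n, neumannTerm P⁻¹ K (K * R - S) n U =
      P⁻¹ * ((∑' n, (star (U : Mat L) * K) ^ n) * (star (U : Mat L) * (K * R - S))) := by
    have hs : Summable fun n => (star (U : Mat L) * K) ^ n := summable_geometric_of_norm_lt_one hX
    exact ((hs.hasSum.mul_right _).mul_left _).tsum_eq
  have hgeom := mul_neg_geom_series _ hX
  have hX' : X = Y * (P⁻¹ * R + P⁻¹ * ((∑' n, (star (U : Mat L) * K) ^ n) *
      (star (U : Mat L) * (K * R - S)))) := by
    refine hU.mul_left_cancel ?_
    rw [← mul_assoc, h1, h2, mul_assoc, mul_assoc, ← mul_add, mul_nonsing_inv_cancel_left _ _ hP',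
      mul_add, ← mul_assoc (1 - _) (∑' n, _), hgeom]
    congr 1
    noncomm_ring
  rw [hsum, hX', nonsing_inv_mul_cancel_left _ _ ((isUnit_iff_isUnit_det _).1 hAZ)]

theorem scalar_mem_unitaryGroup (L : ℕ) {c : ℂ} (hc : ‖c‖ = 1) :
    c • (1 : Mat L) ∈ unitaryGroup (Fin L) ℂ := by
  rw [mem_unitaryGroup_iff]
  have : c * star c = 1 := by
    rw [Complex.star_def, Complex.mul_conj, Complex.normSq_eq_norm_sq, hc]; simp
  rw [star_smul, star_one, smul_mul_smul_comm, this, one_smul, one_mul]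

theorem integral_neumannTerm {L : ℕ} (μ : Measure (unitaryGroup (Fin L) ℂ)) [μ.IsHaarMeasure]
    (a K M : Mat L) (n : ℕ) : ∫ U, neumannTerm a K M n U ∂μ = 0 := by
  set c : ℂ := Complex.exp ((Real.pi / (n + 1) : ℝ) * Complex.I) with hc
  have hc1 : ‖c‖ = 1 := Complex.norm_exp_ofReal_mul_I _
  have hcn : star c ^ (n + 1) = -1 := by
    have : c ^ (n + 1) = -1 := by
      rw [hc, ← Complex.exp_nat_mul, ← Complex.exp_pi_mul_I]
      congr 1
      push_cast
      field_simp
    rw [← star_pow, this]; simp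
  have hU (U : unitaryGroup (Fin L) ℂ) :
      neumannTerm a K M n (⟨c • 1, scalar_mem_unitaryGroup L hc1⟩ * U) =
        -neumannTerm a K M n U := by
    have hs : star (((⟨c • 1, scalar_mem_unitaryGroup L hc1⟩ * U : unitaryGroup (Fin L) ℂ)) : Mat L)
        = star c • star (U : Mat L) := by
      simp [star_smul]
    simp only [neumannTerm, hs, smul_mul_assoc, mul_smul_comm, smul_pow, smul_smul]
    rw [← pow_succ', hcn, neg_one_smul]
  have := integral_mul_left_eq_self (μ := μ) (neumannTerm a K M n)
    ⟨c • 1, scalar_mem_unitaryGroup L hc1⟩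
  simp only [hU, integral_neg] at this
  have h2 : (2 : ℝ) • ∫ U, neumannTerm a K M n U ∂μ = 0 := by
    rw [two_smul]
    nth_rw 1 [← this]
    exact neg_add_cancel _
  exact (smul_eq_zero.1 h2).resolve_left two_ne_zero

theorem integrable_neumannSeries {L : ℕ} (μ : Measure (unitaryGroup (Fin L) ℂ))
    [IsProbabilityMeasure μ] (a : Mat L) {K : Mat L} (hK : ‖K‖ < 1) (M : Mat L) :
    Integrable (fun U => ∑' n, neumannTerm a K M n U) μ := by
  have hb := summable_neumannBound a hK M
  refine .of_bound (continuous_tsum (continuous_neumannTerm a K M) hb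
    (norm_neumannTerm_le a K M)).aestronglyMeasurable (∑' n : ℕ, ‖a‖ * (‖K‖ ^ n * ‖M‖))
    (ae_of_all _ fun U => tsum_of_norm_bounded hb.hasSum fun n => norm_neumannTerm_le a K M n U)

theorem integral_neumannSeries {L : ℕ} (μ : Measure (unitaryGroup (Fin L) ℂ)) [μ.IsHaarMeasure]
    [IsProbabilityMeasure μ] (a : Mat L) {K : Mat L} (hK : ‖K‖ < 1) (M : Mat L) :
    ∫ U, ∑' n, neumannTerm a K M n U ∂μ = 0 := by
  have hi (n : ℕ) : Integrable (neumannTerm a K M n) μ :=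
    .of_bound (continuous_neumannTerm a K M n).aestronglyMeasurable _
      (ae_of_all _ fun U => norm_neumannTerm_le a K M n U)
  have hs : Summable fun n => ∫ U, ‖neumannTerm a K M n U‖ ∂μ := by
    refine .of_nonneg_of_le (fun n => integral_nonneg fun _ => norm_nonneg _) (fun n => ?_)
      (summable_neumannBound a hK M)
    simpa using integral_mono (hi n).norm (integrable_const _) (norm_neumannTerm_le a K M n)
  have := hasSum_integral_of_summable_integral_norm hi hs
  simp only [integral_neumannTerm] at this
  exact this.unique hasSum_zero

theorem card_filter_det_one_sub_smul_le {L : ℕ} (M : Mat L) (s : Finset ℂ) (hs : 0 ∉ s) :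
    (s.filter fun c => (1 - c • M).det = 0).card ≤ L := by
  have hd : M.charpoly.natDegree = L := by simp
  refine le_trans ?_ ((M.charpoly.card_roots'.trans' (Multiset.toFinset_card_le _)).trans_eq hd)
  refine Finset.card_le_card_of_injOn (·⁻¹) (fun c hc => ?_) (inv_injective.injOn)
  obtain ⟨hc, hdet⟩ := Finset.mem_filter.1 hc
  have hc0 : c ≠ 0 := fun h => hs (h ▸ hc)
  have : scalar (Fin L) c⁻¹ - M = c⁻¹ • (1 - c • M) := by
    rw [smul_sub, smul_smul, inv_mul_cancel₀ hc0, one_smul, smul_one_eq_diagonal]; rfl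
  have hr : M.charpoly.IsRoot c⁻¹ := by
    rw [Polynomial.IsRoot, eval_charpoly, this, det_smul, hdet, mul_zero]
  simpa [M.charpoly_monic.ne_zero] using hr

theorem ae_isUnit_one_sub {L : ℕ} (μ : Measure (unitaryGroup (Fin L) ℂ)) [μ.IsHaarMeasure]
    [IsProbabilityMeasure μ] : ∀ᵐ U : unitaryGroup (Fin L) ℂ ∂μ, IsUnit (1 - (U : Mat L)) := by
  set E : Set (unitaryGroup (Fin L) ℂ) := {U | (1 - (U : Mat L)).det = 0} with hE
  have hEm : MeasurableSet E := by
    refine IsClosed.measurableSet (isClosed_eq ?_ continuous_const)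
    exact (continuous_const.sub continuous_subtype_val).matrix_det
  have hE0 : {U : unitaryGroup (Fin L) ℂ | ¬ IsUnit (1 - (U : Mat L))} = E := by
    ext U; simp [hE, isUnit_iff_isUnit_det]
  rw [ae_iff, hE0]
  by_contra hμ
  obtain ⟨n, hn⟩ := ENNReal.exists_nat_mul_gt hμ (ENNReal.natCast_ne_top L)
  have hn0 : n ≠ 0 := by rintro rfl; simp at hn
  have hζ := Complex.isPrimitiveRoot_exp n hn0
  set ζ := Complex.exp (2 * Real.pi * Complex.I / n)
  have hnorm (k : ℕ) : ‖ζ ^ k‖ = 1 := by rw [norm_pow, hζ.norm'_eq_one hn0, one_pow]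
  have hcount (U : unitaryGroup (Fin L) ℂ) : ∑ k ∈ Finset.range n,
      E.indicator (1 : unitaryGroup (Fin L) ℂ → ENNReal)
        (⟨ζ ^ k • 1, scalar_mem_unitaryGroup L (hnorm k)⟩ * U) ≤ L := by
    have hcard := card_filter_det_one_sub_smul_le (U : Mat L)
      ((Finset.range n).image (ζ ^ ·)) (by simp [hζ.ne_zero hn0])
    rw [Finset.filter_image, Finset.card_image_of_injOn] at hcard
    · simp only [Set.indicator_apply, Pi.one_apply, Finset.sum_boole]
      refine le_trans ?_ (Nat.cast_le.2 hcard)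
      simp [hE]
    · intro i hi j hj hij
      simp only [Finset.coe_filter, Set.mem_ofPred_eq, Finset.mem_range] at hi hj
      exact hζ.pow_inj hi.1 hj.1 hij
  refine hn.not_ge ?_
  calc (n : ENNReal) * μ E
      = ∑ k ∈ Finset.range n, ∫⁻ U, E.indicator (1 : unitaryGroup (Fin L) ℂ → ENNReal)
          (⟨ζ ^ k • 1, scalar_mem_unitaryGroup L (hnorm k)⟩ * U) ∂μ := by
        simp [lintegral_mul_left_eq_self (μ := μ)
            (E.indicator (1 : unitaryGroup (Fin L) ℂ → ENNReal)),
          lintegral_indicator_one hEm]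
    _ = ∫⁻ U, ∑ k ∈ Finset.range n, E.indicator (1 : unitaryGroup (Fin L) ℂ → ENNReal)
          (⟨ζ ^ k • 1, scalar_mem_unitaryGroup L (hnorm k)⟩ * U) ∂μ := by
        refine (lintegral_finsetSum _ fun k _ => ?_).symm
        exact (measurable_one.indicator hEm).comp (measurable_const_mul _)
    _ ≤ ∫⁻ _, L ∂μ := lintegral_mono hcount
    _ = L := by simp

theorem stmt6 (L N : ℕ) (hL : 1 ≤ L) (hN : 1 ≤ N)
    (T V : ℕ → Mat L) (hT1 : T 1 = 1)
    (hTinv : ∀ n, 2 ≤ n → n ≤ N → IsUnit (T n))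
    (hV : ∀ n, 1 ≤ n → n ≤ N → (V n).IsHermitian)
    (μ : Measure (Matrix.unitaryGroup (Fin L) ℂ))
    [μ.IsHaarMeasure] [IsProbabilityMeasure μ]
    (z : ℂ) (hz : 0 < z.im) :
    IsUnit (blockA L N T V z + Complex.I • blockC L N T V z) ∧
    (∀ᵐ (U : Matrix.unitaryGroup (Fin L) ℂ) ∂μ, IsUnit (1 - (U : Mat L)) ∧
      IsUnit (jacobi L N T V 0 (ZofU L U) - z • 1)) ∧
    (∀ i j : Fin L, Integrable (fun U => green L N hN T V 0 (ZofU L U) z i j) μ) ∧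
    (∀ i j : Fin L,
      (∫ U, green L N hN T V 0 (ZofU L U) z i j ∂μ) =
        ((blockA L N T V z + Complex.I • blockC L N T V z)⁻¹
          * (blockB L N T V z + Complex.I • blockD L N T V z)) i j) := by
  have hS := sympForm_posDef hN hT1 hTinv hV hz
  have hae := ae_isUnit_one_sub μ
  have hK := norm_cayley_lt_one hS
  set A := blockA L N T V z
  set B := blockB L N T V z
  set C := blockC L N T V z
  set D := blockD L N T V z
  set K := (A - Complex.I • C) * (A + Complex.I • C)⁻¹
  set M := K * (B + Complex.I • D) - (B - Complex.I • D)
  have hG : (fun U => green L N hN T V 0 (ZofU L U) z) =ᵐ[μ] fun U =>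
      (A + Complex.I • C)⁻¹ * (B + Complex.I • D) +
        ∑' n, neumannTerm (A + Complex.I • C)⁻¹ K M n U := by
    filter_upwards [hae] with U hU
    rw [green_eq hN hT1 hTinv (isUnit_add_ZofU_mul hU hS), inv_add_ZofU_mul hU hS]
  have hint := integrable_neumannSeries μ (A + Complex.I • C)⁻¹ hK M
  have hGint : Integrable (fun U => green L N hN T V 0 (ZofU L U) z) μ :=
    ((integrable_const _).add hint).congr hG.symm
  have hGeq : ∫ U, green L N hN T V 0 (ZofU L U) z ∂μ =
      (A + Complex.I • C)⁻¹ * (B + Complex.I • D) := by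
    rw [integral_congr_ae hG, integral_add (integrable_const _) hint,
      integral_neumannSeries μ _ hK]
    simp
  refine ⟨isUnit_add_I_smul hS, ?_, fun i j => ?_, fun i j => ?_⟩
  · filter_upwards [hae] with U hU
    exact ⟨hU, isUnit_jacobi_sub hN hT1 hTinv (isUnit_add_ZofU_mul hU hS)⟩
  · exact (LinearMap.toContinuousLinearMap (entryLinearMap ℂ ℂ i j)).integrable_comp hGint
  · rw [← hGeq]
    exact (LinearMap.toContinuousLinearMap (entryLinearMap ℂ ℂ i j)).integral_comp_comm hGint
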